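/- There exists an absolute constant c > 0 such that for every convex body D ⊆ ℝ² and every point x in the interior of D, one has U(x,D) ≤ c·L(x,D). -/

import Mathlib

open MeasureTheory Set Pointwise

noncomputable section

abbrev E (d : ℕ) := EuclideanSpace ℝ (Fin d)
abbrev E2 := EuclideanSpace ℝ (Fin 2)

/-- The Christoffel function `λ_n(x, D)` for Lebesgue measure on `D ⊆ ℝ^d`. -/
noncomputable def christoffel (d n : ℕ) (x : E d) (D : Set (E d)) : ℝ :=
  sInf { r : ℝ | ∃ p : MvPolynomial (Fin d) ℝ, p.totalDegree ≤ n ∧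
    MvPolynomial.eval (fun i => x i) p = 1 ∧
    r = ∫ y in D, (MvPolynomial.eval (fun i => y i) p) ^ 2 }

/-- Determinant of the linear part of an affine automorphism of `ℝ^d`. -/
noncomputable def adet {d : ℕ} (T : E d ≃ᵃ[ℝ] E d) : ℝ :=
  LinearMap.det (T.linear : E d →ₗ[ℝ] E d)

/-- The closed unit ball `B` of `ℝ²`. -/
def ballE : Set E2 := Metric.closedBall 0 1

/-- The unit square `S = [0,1]²` in `ℝ²`. -/
def squareS : Set E2 := {y : E2 | y 0 ∈ Icc (0:ℝ) 1 ∧ y 1 ∈ Icc (0:ℝ) 1}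

/-- The geometric quantity `L(x, D)`. -/
noncomputable def Lfun (x : E2) (D : Set E2) : ℝ :=
  sSup { r : ℝ | ∃ T : E2 ≃ᵃ[ℝ] E2, x ∈ T '' ballE ∧ T '' ballE ⊆ D ∧
    r = Real.sqrt (1 - ‖T.symm x‖) * |adet T| }

/-- The geometric quantity `U(x, D)`. -/
noncomputable def Ufun (x : E2) (D : Set E2) : ℝ :=
  sInf { r : ℝ | ∃ T : E2 ≃ᵃ[ℝ] E2, x ∈ T '' ((2:ℝ)⁻¹ • squareS) ∧ D ⊆ T '' squareS ∧
    r = Real.sqrt ((T.symm x) 0 * (T.symm x) 1) * |adet T| }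

/-- A convex body in `ℝ²`: a compact convex set with nonempty interior. -/
def IsConvexBody (D : Set E2) : Prop := Convex ℝ D ∧ IsCompact D ∧ (interior D).Nonempty

/-- The point `(a, b)` of `ℝ²`. -/
noncomputable def e2 (a b : ℝ) : E2 := (WithLp.equiv 2 (Fin 2 → ℝ)).symm ![a, b]

lemma exists_affineEquiv_coords (a b e c d f : ℝ) (h : a * d - b * c ≠ 0) :
    ∃ T : E2 ≃ᵃ[ℝ] E2, (∀ z, T z 0 = a * z 0 + b * z 1 + e ∧ T z 1 = c * z 0 + d * z 1 + f) ∧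
      adet T = a * d - b * c := by
  have hdet : LinearMap.det (Matrix.toLpLin 2 2 !![a, b; c, d]) = a * d - b * c := by
    rw [LinearMap.det_toLpLin, Matrix.det_fin_two_of]
  refine ⟨(LinearMap.equivOfDetNeZero (Matrix.toLpLin 2 2 !![a, b; c, d])
    (by rwa [hdet])).toAffineEquiv.trans (AffineEquiv.constVAdd ℝ E2 (!₂[e, f] : E2)), ?_, ?_⟩
  · intro z
    simp [LinearMap.equivOfDetNeZero, Matrix.toLpLin_apply, Fin.sum_univ_two,
      dotProduct, add_comm]
  · exact hdet

lemma adet_trans {d : ℕ} (T A : E d ≃ᵃ[ℝ] E d) : adet (T.trans A) = adet A * adet T :=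
  LinearMap.det_comp (A.linear : E d →ₗ[ℝ] E d) (T.linear : E d →ₗ[ℝ] E d)

lemma adet_mul_adet_symm {d : ℕ} (T : E d ≃ᵃ[ℝ] E d) : adet T * adet T.symm = 1 := by
  rw [← adet_trans, AffineEquiv.symm_trans_self]
  exact LinearMap.det_id

lemma adet_ne_zero {d : ℕ} (T : E d ≃ᵃ[ℝ] E d) : adet T ≠ 0 :=
  left_ne_zero_of_mul_eq_one (adet_mul_adet_symm T)

lemma adet_symm {d : ℕ} (T : E d ≃ᵃ[ℝ] E d) : adet T.symm = (adet T)⁻¹ :=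
  eq_inv_of_mul_eq_one_right (adet_mul_adet_symm T)

lemma mem_half_squareS {y : E2} :
    y ∈ (2:ℝ)⁻¹ • squareS ↔ y 0 ∈ Icc (0:ℝ) (1 / 2) ∧ y 1 ∈ Icc (0:ℝ) (1 / 2) := by
  rw [Set.mem_inv_smul_set_iff₀ two_ne_zero]
  simp only [squareS, mem_ofPred_eq, PiLp.smul_apply, smul_eq_mul, mem_Icc]
  constructor <;> rintro ⟨⟨_, _⟩, _, _⟩ <;> refine ⟨⟨?_, ?_⟩, ?_, ?_⟩ <;> linarith

/-- At every scale `r`, either some inscribed ellipse witnesses `L(x, D) ≥ r`, or some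
circumscribed parallelogram witnesses `U(x, D) ≤ C * r`. -/
def EllipseOrParallelogram (C : ℝ) (x : E2) (D : Set E2) : Prop :=
  ∀ r : ℝ, 0 < r →
    (∃ T : E2 ≃ᵃ[ℝ] E2, x ∈ T '' ballE ∧ T '' ballE ⊆ D ∧
      r ≤ Real.sqrt (1 - ‖T.symm x‖) * |adet T|) ∨
    (∃ T : E2 ≃ᵃ[ℝ] E2, x ∈ T '' ((2:ℝ)⁻¹ • squareS) ∧ D ⊆ T '' squareS ∧
      Real.sqrt ((T.symm x) 0 * (T.symm x) 1) * |adet T| ≤ C * r)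

lemma EllipseOrParallelogram.of_image {C : ℝ} {x : E2} {D : Set E2} (A : E2 ≃ᵃ[ℝ] E2)
    (h : EllipseOrParallelogram C (A x) (A '' D)) : EllipseOrParallelogram C x D := by
  intro r hr
  have hA : 0 < |adet A| := abs_pos.2 (adet_ne_zero A)
  rcases h (|adet A| * r) (by positivity) with
    ⟨T, ⟨y, hy, hyx⟩, hTD, hT⟩ | ⟨T, ⟨y, hy, hyx⟩, hDT, hT⟩
  · refine .inl ⟨T.trans A.symm, ⟨y, hy, by simp [hyx]⟩, ?_, ?_⟩
    · rintro _ ⟨z, hz, rfl⟩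
      obtain ⟨w, hw, hwz⟩ := hTD ⟨z, hz, rfl⟩
      simpa [← hwz] using hw
    · rw [adet_trans, adet_symm, abs_mul, abs_inv]
      have : (T.trans A.symm).symm x = T.symm (A x) := rfl
      rw [this]
      rw [← mul_le_mul_iff_right₀ hA]
      calc _ ≤ _ := hT
        _ = _ := by field_simp
  · refine .inr ⟨T.trans A.symm, ⟨y, hy, by simp [hyx]⟩, ?_, ?_⟩
    · intro z hz
      obtain ⟨w, hw, hwz⟩ := hDT ⟨z, hz, rfl⟩
      exact ⟨w, hw, by simp [hwz]⟩
    · rw [adet_trans, adet_symm, abs_mul, abs_inv]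
      have : (T.trans A.symm).symm x = T.symm (A x) := rfl
      rw [this]
      rw [← mul_le_mul_iff_right₀ hA]
      calc _ = _ := by field_simp
        _ ≤ _ := hT
        _ = _ := by ring

lemma exists_parallelogram_of_coords {D : Set E2} {x : E2} (a b e c d f : ℝ)
    (h : a * d - b * c ≠ 0)
    (hD : ∀ z ∈ D, a * z 0 + b * z 1 + e ∈ Icc (0:ℝ) 1 ∧ c * z 0 + d * z 1 + f ∈ Icc (0:ℝ) 1)
    (hx : a * x 0 + b * x 1 + e ∈ Icc (0:ℝ) (1 / 2) ∧ c * x 0 + d * x 1 + f ∈ Icc (0:ℝ) (1 / 2)) :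
    ∃ T : E2 ≃ᵃ[ℝ] E2, x ∈ T '' ((2:ℝ)⁻¹ • squareS) ∧ D ⊆ T '' squareS ∧
      Real.sqrt ((T.symm x) 0 * (T.symm x) 1) * |adet T| =
      Real.sqrt ((a * x 0 + b * x 1 + e) * (c * x 0 + d * x 1 + f)) * |a * d - b * c|⁻¹ := by
  obtain ⟨A, hA, hdet⟩ := exists_affineEquiv_coords a b e c d f h
  refine ⟨A.symm, ⟨A x, mem_half_squareS.2 ?_, by simp⟩, fun z hz => ⟨A z, ?_, by simp⟩, ?_⟩
  · rw [(hA x).1, (hA x).2]; exact hx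
  · rw [squareS, mem_ofPred_eq, (hA z).1, (hA z).2]; exact hD z hz
  · rw [adet_symm, hdet, show A.symm.symm = A from rfl, (hA x).1, (hA x).2, abs_inv]

lemma bddAbove_ellipse {D : Set E2} (hD : IsCompact D) (x : E2) :
    BddAbove { r : ℝ | ∃ T : E2 ≃ᵃ[ℝ] E2, x ∈ T '' ballE ∧ T '' ballE ⊆ D ∧
      r = Real.sqrt (1 - ‖T.symm x‖) * |adet T| } := by
  refine ⟨(volume D).toReal / (volume ballE).toReal, ?_⟩
  rintro r ⟨T, -, hT, rfl⟩
  have hfin : volume ballE ≠ ⊤ := (isCompact_closedBall (0:E2) 1).measure_lt_top.ne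
  have hpos : 0 < (volume ballE).toReal :=
    ENNReal.toReal_pos (Metric.measure_closedBall_pos _ _ one_pos).ne' hfin
  have himg : T '' ballE = (fun z => T 0 + z) '' ((T.linear : E2 →ₗ[ℝ] E2) '' ballE) := by
    rw [image_image]
    refine image_congr fun z _ => ?_
    have := T.map_vadd 0 z
    simpa [add_comm] using this
  have hvol : volume (T '' ballE) = ENNReal.ofReal |adet T| * volume ballE := by
    rw [himg, image_add_left, measure_preimage_add, Measure.addHaar_image_linearMap]
    rfl
  have hle : |adet T| * (volume ballE).toReal ≤ (volume D).toReal := by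
    have h1 := ENNReal.toReal_mono hD.measure_lt_top.ne (measure_mono (μ := volume) hT)
    rwa [hvol, ENNReal.toReal_mul, ENNReal.toReal_ofReal (abs_nonneg _)] at h1
  rw [le_div_iff₀ hpos]
  refine le_trans ?_ hle
  gcongr
  refine mul_le_of_le_one_left (abs_nonneg _) ?_
  exact Real.sqrt_le_one.2 (by linarith [norm_nonneg (T.symm x)])

lemma EllipseOrParallelogram.Ufun_le {C : ℝ} (hC : 0 < C) {x : E2} {D : Set E2}
    (hD : IsCompact D) (h : EllipseOrParallelogram C x D) : Ufun x D ≤ C * Lfun x D := by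
  have hL : 0 ≤ Lfun x D := by
    refine Real.sSup_nonneg ?_
    rintro r ⟨T, -, -, rfl⟩
    positivity
  refine le_of_forall_pos_le_add fun ε hε => ?_
  rcases h (Lfun x D + ε / C) (by positivity) with ⟨T, hx, hT, hr⟩ | ⟨T, hx, hT, hr⟩
  · have := le_csSup (bddAbove_ellipse hD x) ⟨T, hx, hT, rfl⟩
    have hε' : 0 < ε / C := by positivity
    change _ ≤ Lfun x D at this
    linarith
  · calc Ufun x D ≤ _ := csInf_le ⟨0, ?_⟩ ⟨T, hx, hT, rfl⟩
      _ ≤ _ := hr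
      _ = C * Lfun x D + ε := by field_simp
    rintro r ⟨T, -, -, rfl⟩
    positivity

lemma clm_apply_coords (f : E2 →L[ℝ] ℝ) : ∃ a b : ℝ, ∀ z : E2, f z = a * z 0 + b * z 1 := by
  refine ⟨f (EuclideanSpace.single 0 1), f (EuclideanSpace.single 1 1), fun z => ?_⟩
  have hz : z = z 0 • EuclideanSpace.single 0 1 + z 1 • EuclideanSpace.single 1 (1:ℝ) := by
    ext i; fin_cases i <;> simp
  conv_lhs => rw [hz]
  rw [map_add, map_smul, map_smul, smul_eq_mul, smul_eq_mul]
  ring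

/-- If an inscribed ellipse of half-width `w` with lowest point `(0, t / 2)` leaves `D` at `q`,
then a line separating `q` from `D` yields an efficient circumscribed parallelogram. -/
lemma exists_parallelogram_of_notMem {D : Set E2} {x q : E2} {w : ℝ} (hconv : Convex ℝ D)
    (hcl : IsClosed D) (h0 : (0 : E2) ∈ D) (hr : (!₂[1, 1] : E2) ∈ D) (hl : (!₂[-1, 1] : E2) ∈ D)
    (hR : ∀ z ∈ D, |z 0| ≤ 256 ∧ 0 ≤ z 1 ∧ z 1 ≤ 256) (hx0 : x 0 = 0) (hx1 : 0 < x 1)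
    (hw : 0 < w) (hq0 : |q 0| ≤ 1 / 2) (hq1 : q 1 ≤ 1)
    (hq : x 1 / 2 + q 0 ^ 2 / (8 * w ^ 2) ≤ q 1) (hqD : q ∉ D) :
    ∃ T : E2 ≃ᵃ[ℝ] E2, x ∈ T '' ((2:ℝ)⁻¹ • squareS) ∧ D ⊆ T '' squareS ∧
      Real.sqrt ((T.symm x) 0 * (T.symm x) 1) * |adet T| ≤ 2048 * (w * Real.sqrt (x 1)) := by
  obtain ⟨g, v, hgq, hgD⟩ := geometric_hahn_banach_point_closed hconv hcl hqD
  obtain ⟨a, b, hg⟩ := clm_apply_coords g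
  have hlt : ∀ z ∈ D, a * q 0 + b * q 1 < a * z 0 + b * z 1 := fun z hz => by
    rw [← hg, ← hg]; exact hgq.trans (hgD z hz)
  have hlt0 : a * q 0 + b * q 1 < 0 := by simpa using hlt _ h0
  have hltr : a * q 0 + b * q 1 < a + b := by simpa using hlt _ hr
  have hltl : a * q 0 + b * q 1 < -a + b := by simpa using hlt _ hl
  have hqsq : 0 ≤ q 0 ^ 2 / (8 * w ^ 2) := by positivity
  have hq1pos : 0 < q 1 := by linarith
  obtain ⟨hq0l, hq0r⟩ := abs_le.1 hq0
  have hb : 0 < b := by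
    by_contra! hb
    have : b * (1 - q 1) ≤ 0 := mul_nonpos_of_nonpos_of_nonneg hb (by linarith)
    rcases le_total 0 a with ha | ha <;> nlinarith
  obtain ⟨s, rfl⟩ : ∃ s, a = s * b := ⟨a / b, by field_simp⟩
  have hlt' : ∀ z ∈ D, s * q 0 + q 1 < s * z 0 + z 1 := fun z hz => by
    have := hlt z hz
    refine lt_of_mul_lt_mul_right ?_ hb.le
    linarith
  have hs0 : s * q 0 + q 1 < 0 := by simpa using hlt' _ h0
  have hsr : s * q 0 + q 1 < s + 1 := by simpa using hlt' _ hr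
  have hsl : s * q 0 + q 1 < -s + 1 := by simpa using hlt' _ hl
  have hs : |s| ≤ 2 := abs_le.2 ⟨by nlinarith, by nlinarith⟩
  have hsne : s ≠ 0 := by rintro rfl; linarith
  obtain ⟨k, hk⟩ : ∃ k, k = -(s * q 0) := ⟨_, rfl⟩
  have hk1 : k ≤ 1 := by
    have : |s * q 0| ≤ 2 * (1 / 2) := by rw [abs_mul]; gcongr
    have := neg_abs_le (s * q 0)
    linarith
  have hkpos : 0 < k := by linarith
  have hkw : k ≤ 8 * s ^ 2 * w ^ 2 := by
    have h1 : q 0 ^ 2 ≤ 8 * w ^ 2 * k := by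
      have : q 0 ^ 2 / (8 * w ^ 2) ≤ k := by linarith
      rw [div_le_iff₀ (by positivity)] at this
      linarith
    have h2 : k * k ≤ 8 * s ^ 2 * w ^ 2 * k := by
      calc k * k = s ^ 2 * q 0 ^ 2 := by rw [hk]; ring
        _ ≤ s ^ 2 * (8 * w ^ 2 * k) := by gcongr
        _ = _ := by ring
    exact le_of_mul_le_mul_right h2 hkpos
  obtain ⟨T, hT1, hT2, hT3⟩ := exists_parallelogram_of_coords (D := D) (x := x)
    0 (1 / 256) 0 (s / 1024) (1 / 1024) ((k - q 1) / 1024) (by simpa using hsne)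
    (fun z hz => by
      obtain ⟨hz0, hz1, hz2⟩ := hR z hz
      have hsz := hlt' z hz
      have : |s * z 0| ≤ 2 * 256 := by rw [abs_mul]; gcongr
      have := le_abs_self (s * z 0)
      refine ⟨⟨?_, ?_⟩, ?_, ?_⟩ <;> linarith)
    (by rw [hx0]; refine ⟨⟨?_, ?_⟩, ?_, ?_⟩ <;> linarith)
  refine ⟨T, hT1, hT2, hT3.trans_le ?_⟩
  rw [hx0]
  have hdet : |0 * (1 / 1024) - 1 / 256 * (s / 1024)|⁻¹ = 262144 / |s| := by
    have : 0 * (1 / 1024) - 1 / 256 * (s / 1024) = -(s / 262144) := by ring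
    rw [this, abs_neg, abs_div, inv_div]
    norm_num
  rw [hdet, mul_div_assoc', div_le_iff₀ (abs_pos.2 hsne)]
  have hsqrt : Real.sqrt ((0 * 0 + 1 / 256 * x 1 + 0) *
      (s / 1024 * 0 + 1 / 1024 * x 1 + (k - q 1) / 1024)) ≤ |s| * w * Real.sqrt (x 1) / 128 := by
    refine Real.sqrt_le_iff.2 ⟨by positivity, ?_⟩
    rw [div_pow, mul_pow, mul_pow, sq_abs, Real.sq_sqrt hx1.le]
    have : x 1 + (k - q 1) ≤ 16 * (s ^ 2 * w ^ 2) := by linarith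
    have := mul_le_mul_of_nonneg_right this hx1.le
    linarith
  linarith

/-- The conclusion for bodies that touch the horizontal axis at the origin from above, have
controlled size, and contain two fixed points above the origin. -/
lemma ellipseOrParallelogram_of_normalized {D : Set E2} {x : E2} (hconv : Convex ℝ D)
    (hcl : IsClosed D) (h0 : (0 : E2) ∈ D) (hr : (!₂[1, 1] : E2) ∈ D) (hl : (!₂[-1, 1] : E2) ∈ D)
    (hR : ∀ z ∈ D, |z 0| ≤ 256 ∧ 0 ≤ z 1 ∧ z 1 ≤ 256) (hx0 : x 0 = 0) (hx1 : 0 < x 1)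
    (hx2 : x 1 ≤ 16 / 17) : EllipseOrParallelogram 1000000 x D := by
  intro r hr0
  have hst : 0 < Real.sqrt (x 1) := Real.sqrt_pos.2 hx1
  obtain ⟨w, hw⟩ : ∃ w, w = 20 * r / Real.sqrt (x 1) := ⟨_, rfl⟩
  have hwpos : 0 < w := by rw [hw]; positivity
  have hwr : w * Real.sqrt (x 1) = 20 * r := by rw [hw]; field_simp
  rcases le_or_gt w (1 / 2) with hw2 | hw2
  · have hhpos : 0 < 1 / 2 - x 1 / 4 := by linarith
    obtain ⟨T, hT, hdet⟩ := exists_affineEquiv_coords w 0 0 0 (1 / 2 - x 1 / 4) (1 / 2 + x 1 / 4)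
      (by simpa using ⟨hwpos.ne', by linarith⟩)
    by_cases hTD : T '' ballE ⊆ D
    · left
      have hsymm : T.symm x = !₂[0, (3 * x 1 - 2) / (2 - x 1)] := by
        rw [← T.injective.eq_iff, T.apply_symm_apply]
        have h2 : 2 - x 1 ≠ 0 := by linarith
        ext i
        fin_cases i
        · simp [hT, hx0]
        · simp only [Fin.mk_one, hT]
          simp
          field_simp
          ring
      have hnorm : ‖T.symm x‖ ≤ 1 - x 1 / 17 := by
        rw [hsymm, EuclideanSpace.norm_eq]
        simp only [Fin.sum_univ_two, Real.norm_eq_abs, sq_abs]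
        simp only [Matrix.cons_val_zero, Matrix.cons_val_one]
        rw [zero_pow two_ne_zero, zero_add, Real.sqrt_sq_eq_abs, abs_le, le_div_iff₀ (by linarith),
          div_le_iff₀ (by linarith)]
        constructor <;> nlinarith
      refine ⟨T, ⟨T.symm x, ?_, by simp⟩, hTD, ?_⟩
      · rw [ballE, mem_closedBall_zero_iff]
        linarith
      · rw [hdet, mul_zero, sub_zero, abs_of_pos (by positivity)]
        have h5 : Real.sqrt (x 1) / 5 ≤ Real.sqrt (1 - ‖T.symm x‖) := by
          refine Real.le_sqrt_of_sq_le ?_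
          rw [div_pow, Real.sq_sqrt hx1.le]
          linarith
        calc r = Real.sqrt (x 1) / 5 * (w * (1 / 4)) := by linarith
          _ ≤ _ := by gcongr; linarith
    · right
      obtain ⟨_, ⟨z, hz, rfl⟩, hqD⟩ := not_subset.1 hTD
      have hz' : z 0 ^ 2 + z 1 ^ 2 ≤ 1 := by
        rw [ballE, mem_closedBall_zero_iff, EuclideanSpace.norm_eq, Real.sqrt_le_one] at hz
        simpa [Fin.sum_univ_two] using hz
      have hz0 : |z 0| ≤ 1 := abs_le_one_iff_mul_self_le_one.2 (by nlinarith)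
      have hz1 : |z 1| ≤ 1 := abs_le_one_iff_mul_self_le_one.2 (by nlinarith)
      obtain ⟨hz1l, hz1r⟩ := abs_le.1 hz1
      obtain ⟨S, hS1, hS2, hS3⟩ := exists_parallelogram_of_notMem hconv hcl h0 hr hl hR hx0 hx1
        hwpos
        (by
          rw [(hT z).1, zero_mul, add_zero, add_zero, abs_mul, abs_of_pos hwpos]
          calc w * |z 0| ≤ 1 / 2 * 1 := by gcongr
            _ = _ := by norm_num)
        (by rw [(hT z).2]; nlinarith)
        (by
          rw [(hT z).1, (hT z).2]
          have : (w * z 0 + 0 * z 1 + 0) ^ 2 / (8 * w ^ 2) = z 0 ^ 2 / 8 := by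
            field_simp
            ring
          rw [this]
          nlinarith)
        hqD
      exact ⟨S, hS1, hS2, by rw [hwr] at hS3; linarith⟩
  · right
    obtain ⟨T, hT1, hT2, hT3⟩ := exists_parallelogram_of_coords (D := D) (x := x)
      (1 / 512) 0 (1 / 2) 0 (1 / 256) 0 (by norm_num)
      (fun z hz => by
        obtain ⟨hz0, hz1, hz2⟩ := hR z hz
        obtain ⟨hz0l, hz0r⟩ := abs_le.1 hz0
        refine ⟨⟨?_, ?_⟩, ?_, ?_⟩ <;> linarith)
      (by rw [hx0]; refine ⟨⟨?_, ?_⟩, ?_, ?_⟩ <;> linarith)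
    refine ⟨T, hT1, hT2, hT3.trans_le ?_⟩
    rw [hx0]
    have hsqrt : Real.sqrt ((1 / 512 * 0 + 0 * x 1 + 1 / 2) * (0 * 0 + 1 / 256 * x 1 + 0)) ≤
        Real.sqrt (x 1) / 16 := by
      refine Real.sqrt_le_iff.2 ⟨by positivity, ?_⟩
      rw [div_pow, Real.sq_sqrt hx1.le]
      linarith
    have hdet : |(1 / 512 : ℝ) * (1 / 256) - 0 * 0|⁻¹ = 131072 := by
      rw [abs_of_pos] <;> norm_num
    rw [hdet]
    nlinarith

lemma AffineEquiv.isCompact_image (A : E2 ≃ᵃ[ℝ] E2) {D : Set E2} (hD : IsCompact D) :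
    IsCompact (A '' D) :=
  hD.image (A : E2 →ᵃ[ℝ] E2).continuous_of_finiteDimensional

lemma AffineEquiv.image_interior (A : E2 ≃ᵃ[ℝ] E2) (D : Set E2) :
    A '' interior D = interior (A '' D) :=
  (AffineEquiv.toContinuousAffineEquiv A).toHomeomorph.image_interior D

/-- A ray from an interior point of a compact set through another point leaves the interior
at a point of the set. -/
lemma exists_smul_eq_notMem_interior {D : Set E2} (hD : IsCompact D) (h0 : (0 : E2) ∈ interior D)
    {x : E2} (hx : x ∈ D) : ∃ p ∈ D, p ∉ interior D ∧ ∃ θ : ℝ, 0 ≤ θ ∧ x = θ • p := by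
  obtain ⟨e, he, τ, hτ, rfl⟩ : ∃ e : E2, e ≠ 0 ∧ ∃ τ : ℝ, 0 ≤ τ ∧ x = τ • e := by
    by_cases h : x = 0
    · exact ⟨EuclideanSpace.single 0 1, by simp, 0, le_rfl, by simp [h]⟩
    · exact ⟨x, h, 1, zero_le_one, by simp⟩
  obtain ⟨σ, hσ, hmax⟩ := ((isClosedEmbedding_smul_left (𝕜 := ℝ) he).isCompact_preimage
    hD).exists_isGreatest ⟨τ, hx⟩
  have hσ' : σ • e ∉ interior D := fun h => by
    have hopen : IsOpen ((fun s : ℝ => s • e) ⁻¹' interior D) :=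
      isOpen_interior.preimage (by fun_prop)
    obtain ⟨s, hs, hlt⟩ := Filter.nonempty_of_mem (Filter.inter_mem
      (nhdsWithin_le_nhds (hopen.mem_nhds h)) (self_mem_nhdsWithin (s := Ioi σ)))
    exact absurd (hmax (interior_subset hs : s • e ∈ D)) (not_le.2 hlt)
  have hτσ : τ ≤ σ := hmax hx
  have hσ0 : σ ≠ 0 := by rintro rfl; simp [h0] at hσ'
  exact ⟨σ • e, hσ, hσ', τ / σ, div_nonneg hτ (hτ.trans hτσ), by rw [smul_smul]; field_simp⟩

lemma ellipseOrParallelogram_of_subset_of_subset {D : Set E2} {x : E2} (hconv : Convex ℝ D)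
    (hD : IsCompact D) (hin : ∀ z : E2, |z 0| ≤ 1 → |z 1| ≤ 1 → z ∈ D)
    (hout : ∀ z ∈ D, |z 0| ≤ 8 ∧ |z 1| ≤ 8) (hx : x ∈ interior D) :
    EllipseOrParallelogram 1000000 x D := by
  have h0 : (0 : E2) ∈ interior D := by
    refine mem_interior.2 ⟨{z : E2 | |z 0| < 1} ∩ {z : E2 | |z 1| < 1},
      fun z hz => hin z (le_of_lt hz.1) (le_of_lt hz.2),
      (isOpen_lt (by fun_prop) (by fun_prop)).inter (isOpen_lt (by fun_prop) (by fun_prop)), ?_⟩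
    constructor <;> simp
  obtain ⟨p, hpD, hp, θ, hθ, rfl⟩ := exists_smul_eq_notMem_interior hD h0 (interior_subset hx)
  obtain ⟨g, hg⟩ := geometric_hahn_banach_open_point hconv.interior isOpen_interior hp
  have hgp : 0 < g p := by simpa using hg 0 h0
  have hgD : ∀ z ∈ D, g z ≤ g p := fun z hz => by
    have hsub : closure (interior D) ⊆ {z | g z ≤ g p} :=
      closure_minimal (fun z hz => (hg z hz).le) (isClosed_le g.continuous continuous_const)
    rw [hconv.closure_interior_eq_closure_of_nonempty_interior ⟨0, h0⟩] at hsub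
    exact hsub (subset_closure hz)
  obtain ⟨a', b', hg'⟩ := clm_apply_coords g
  obtain ⟨a, ha⟩ : ∃ a, a = a' / g p := ⟨_, rfl⟩
  obtain ⟨b, hb⟩ : ∃ b, b = b' / g p := ⟨_, rfl⟩
  have hab : ∀ z : E2, a * z 0 + b * z 1 = g z / g p := fun z => by
    rw [ha, hb, hg' z]; ring
  have habp : a * p 0 + b * p 1 = 1 := by rw [hab, div_self hgp.ne']
  have habD : ∀ z ∈ D, a * z 0 + b * z 1 ≤ 1 := fun z hz => by
    rw [hab, div_le_one hgp]; exact hgD z hz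
  have hθ1 : θ < 1 := by
    have := hg _ hx
    rw [map_smul, smul_eq_mul] at this
    exact lt_of_mul_lt_mul_right (by linarith) hgp.le
  have ha1 : |a| ≤ 1 := by
    refine abs_le'.2 ⟨?_, ?_⟩
    · simpa using habD (!₂[1, 0]) (hin _ (by simp) (by simp))
    · simpa using habD (!₂[-1, 0]) (hin _ (by simp) (by simp))
  have hb1 : |b| ≤ 1 := by
    refine abs_le'.2 ⟨?_, ?_⟩
    · simpa using habD (!₂[0, 1]) (hin _ (by simp) (by simp))
    · simpa using habD (!₂[0, -1]) (hin _ (by simp) (by simp))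
  obtain ⟨A, hA, -⟩ := exists_affineEquiv_coords (-2 * p 1) (2 * p 0) 0 (-(16 / 17) * a)
    (-(16 / 17) * b) (16 / 17) (by
      have : -2 * p 1 * (-(16 / 17) * b) - 2 * p 0 * (-(16 / 17) * a) = 32 / 17 := by
        linear_combination (32 / 17) * habp
      rw [this]; norm_num)
  have hp8 := hout p hpD
  obtain ⟨hp0l, hp0r⟩ := abs_le.1 hp8.1
  obtain ⟨hp1l, hp1r⟩ := abs_le.1 hp8.2
  obtain ⟨hal, har⟩ := abs_le.1 ha1
  obtain ⟨hbl, hbr⟩ := abs_le.1 hb1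
  refine EllipseOrParallelogram.of_image A (ellipseOrParallelogram_of_normalized
    (hconv.affine_image (A : E2 →ᵃ[ℝ] E2)) (A.isCompact_image hD).isClosed
    ⟨p, hpD, ?_⟩ ⟨!₂[-p 0 / 16 - b / 2, -p 1 / 16 + a / 2], ?_, ?_⟩
    ⟨!₂[-p 0 / 16 + b / 2, -p 1 / 16 - a / 2], ?_, ?_⟩ ?_ ?_ ?_ ?_)
  · ext i
    fin_cases i
    · simp [hA]; ring
    · simp [hA]; linear_combination (-(16 / 17)) * habp
  · apply hin <;> simp <;> rw [abs_le] <;> constructor <;> linarith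
  · ext i
    fin_cases i
    · simp [hA]; linear_combination habp
    · simp [hA]; linear_combination (1 / 17) * habp
  · apply hin <;> simp <;> rw [abs_le] <;> constructor <;> linarith
  · ext i
    fin_cases i
    · simp [hA]; linear_combination -habp
    · simp [hA]; linear_combination (1 / 17) * habp
  · rintro _ ⟨z, hz, rfl⟩
    obtain ⟨hz0, hz1⟩ := hout z hz
    have h1 : |p 1 * z 0| ≤ 8 * 8 := by
      rw [abs_mul]
      exact mul_le_mul hp8.2 hz0 (abs_nonneg _) (by norm_num)
    have h2 : |p 0 * z 1| ≤ 8 * 8 := by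
      rw [abs_mul]
      exact mul_le_mul hp8.1 hz1 (abs_nonneg _) (by norm_num)
    have h3 : |a * z 0| ≤ 1 * 8 := by
      rw [abs_mul]
      exact mul_le_mul ha1 hz0 (abs_nonneg _) (by norm_num)
    have h4 : |b * z 1| ≤ 1 * 8 := by
      rw [abs_mul]
      exact mul_le_mul hb1 hz1 (abs_nonneg _) (by norm_num)
    rw [abs_le] at h1 h2 h3 h4
    have := habD z hz
    rw [(hA z).1, (hA z).2, abs_le]
    refine ⟨⟨?_, ?_⟩, ?_, ?_⟩ <;> linarith
  · simp [hA]; ring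
  · have : A (θ • p) 1 = 16 / 17 * (1 - θ) := by
      simp [hA]; linear_combination (-(16 / 17) * θ) * habp
    rw [this]; linarith
  · have : A (θ • p) 1 = 16 / 17 * (1 - θ) := by
      simp [hA]; linear_combination (-(16 / 17) * θ) * habp
    rw [this]; linarith

/-- Twice the signed area of the triangle with vertices `a`, `b`, `c`. -/
def signedArea (a b c : E2) : ℝ := (b 0 - a 0) * (c 1 - a 1) - (b 1 - a 1) * (c 0 - a 0)

lemma exists_signedArea_pos {D : Set E2} {x : E2} (hx : x ∈ interior D) :
    ∃ a ∈ D, ∃ b ∈ D, ∃ c ∈ D, 0 < signedArea a b c := by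
  obtain ⟨ε, hε, hball⟩ := Metric.mem_nhds_iff.1 (mem_interior_iff_mem_nhds.1 hx)
  have hmem : ∀ i : Fin 2, x + EuclideanSpace.single i (ε / 2) ∈ D := fun i => by
    refine hball ?_
    rw [Metric.mem_ball, dist_self_add_left, PiLp.norm_single, Real.norm_eq_abs,
      abs_of_pos (by positivity)]
    linarith
  refine ⟨x, interior_subset hx, _, hmem 0, _, hmem 1, ?_⟩
  simp [signedArea]
  positivity

lemma exists_signedArea_max {D : Set E2} (hD : IsCompact D) (hne : D.Nonempty) :
    ∃ a ∈ D, ∃ b ∈ D, ∃ c ∈ D, ∀ a' ∈ D, ∀ b' ∈ D, ∀ c' ∈ D,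
      signedArea a' b' c' ≤ signedArea a b c := by
  have hcont : Continuous fun y : E2 × E2 × E2 => signedArea y.1 y.2.1 y.2.2 := by
    unfold signedArea
    fun_prop
  obtain ⟨⟨a, b, c⟩, ⟨ha, hb, hc⟩, hmax⟩ := (hD.prod (hD.prod hD)).exists_isMaxOn
    (hne.prod (hne.prod hne)) hcont.continuousOn
  exact ⟨a, ha, b, hb, c, hc, fun a' ha' b' hb' c' hc' =>
    hmax (show (a', b', c') ∈ D ×ˢ D ×ˢ D from ⟨ha', hb', hc'⟩)⟩

lemma IsConvexBody.ellipseOrParallelogram {D : Set E2} (hD : IsConvexBody D) {x : E2}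
    (hx : x ∈ interior D) : EllipseOrParallelogram 1000000 x D := by
  obtain ⟨hconv, hcpt, -⟩ := hD
  obtain ⟨a, ha, b, hb, c, hc, hmax⟩ := exists_signedArea_max hcpt ⟨x, interior_subset hx⟩
  obtain ⟨m, hm⟩ : ∃ m, m = signedArea a b c := ⟨_, rfl⟩
  rw [← hm] at hmax
  have hmpos : 0 < m := by
    obtain ⟨a', ha', b', hb', c', hc', h⟩ := exists_signedArea_pos hx
    exact h.trans_le (hmax a' ha' b' hb' c' hc')
  obtain ⟨A, hA, -⟩ := exists_affineEquiv_coords (6 * (c 1 - a 1) / m) (-6 * (c 0 - a 0) / m)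
    (-6 * (a 0 * (c 1 - a 1) - a 1 * (c 0 - a 0)) / m - 2) (-6 * (b 1 - a 1) / m)
    (6 * (b 0 - a 0) / m) (6 * (a 0 * (b 1 - a 1) - a 1 * (b 0 - a 0)) / m - 2) (by
      have : 6 * (c 1 - a 1) / m * (6 * (b 0 - a 0) / m) -
          -6 * (c 0 - a 0) / m * (-6 * (b 1 - a 1) / m) = 36 / m := by
        field_simp
        rw [hm, signedArea]
        ring
      rw [this]
      positivity)
  have hA0 : ∀ z, A z 0 = 6 * (signedArea a z c / m) - 2 := fun z => by
    rw [(hA z).1, signedArea]; ring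
  have hA1 : ∀ z, A z 1 = 6 * (signedArea a b z / m) - 2 := fun z => by
    rw [(hA z).2, signedArea]; ring
  refine EllipseOrParallelogram.of_image A (ellipseOrParallelogram_of_subset_of_subset
    (hconv.affine_image (A : E2 →ᵃ[ℝ] E2)) (A.isCompact_image hcpt) ?_ ?_
    (A.image_interior D ▸ mem_image_of_mem A hx))
  · intro z hz0 hz1
    rw [abs_le] at hz0 hz1
    have hmem := (hconv.affine_image (A : E2 →ᵃ[ℝ] E2)).sum_mem (t := Finset.univ)
      (w := ![(2 - z 0 - z 1) / 6, (z 0 + 2) / 6, (z 1 + 2) / 6]) (z := ![A a, A b, A c])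
      (by
        intro i _
        fin_cases i <;> simp <;> linarith)
      (by simp [Fin.sum_univ_three]; ring)
      (by
        intro i _
        fin_cases i
        exacts [⟨a, ha, rfl⟩, ⟨b, hb, rfl⟩, ⟨c, hc, rfl⟩])
    refine Set.mem_of_eq_of_mem ?_ hmem
    have h1 : signedArea a a c = 0 := by rw [signedArea]; ring
    have h2 : signedArea a b a = 0 := by rw [signedArea]; ring
    have h3 : signedArea a c c = 0 := by rw [signedArea]; ring
    have h4 : signedArea a b b = 0 := by rw [signedArea]; ring
    ext i
    fin_cases i
    · simp [Fin.sum_univ_three, hA0, h1, h3, ← hm, div_self hmpos.ne']; ring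
    · simp [Fin.sum_univ_three, hA1, h2, h4, ← hm, div_self hmpos.ne']; ring
  · rintro _ ⟨z, hz, rfl⟩
    have hbound : ∀ s : ℝ, s ≤ m → -s ≤ m → |6 * (s / m) - 2| ≤ 8 := fun s h1 h2 => by
      have h3 : s / m ≤ 1 := (div_le_one hmpos).2 h1
      have h4 : -1 ≤ s / m := (le_div_iff₀ hmpos).2 (by linarith)
      rw [abs_le]
      constructor <;> linarith
    rw [hA0, hA1]
    have h1 : signedArea z a c = -signedArea a z c := by simp only [signedArea]; ring
    have h2 : signedArea b a z = -signedArea a b z := by simp only [signedArea]; ring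
    exact ⟨hbound _ (hmax a ha z hz c hc) (h1 ▸ hmax z hz a ha c hc),
      hbound _ (hmax a ha b hb z hz) (h2 ▸ hmax b hb a ha z hz)⟩

/-- There exists an absolute constant `c > 0` such that for every convex body `D ⊆ ℝ²`
and every `x` in the interior of `D`, `U(x,D) ≤ c·L(x,D)`. -/
theorem stmt0 : ∃ c : ℝ, 0 < c ∧ ∀ D : Set E2, IsConvexBody D →
    ∀ x ∈ interior D, Ufun x D ≤ c * Lfun x D := by
  exact ⟨1000000, by norm_num, fun D hD x hx =>
    (hD.ellipseOrParallelogram hx).Ufun_le (by norm_num) hD.2.1⟩
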